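/- For every integer n ≥ 1, the number of ascent sequences of length n that avoid both of the patterns 0121 and 0132 equals the Catalan number C_n = (1/(n+1))·binom(2n,n). -/

import Mathlib

/-- The number of ascents of a word of nonnegative integers. -/
def numAscents (w : List ℕ) : ℕ :=
  (w.zip w.tail).countP (fun p => p.1 < p.2)

/-- A word of nonnegative integers is an ascent sequence if it starts with 0 and
each subsequent entry is at most one more than the number of ascents preceding it. -/
def IsAscentSeq (w : List ℕ) : Prop :=
  w.head? = some 0 ∧
    ∀ i (h : i < w.length), 1 ≤ i → w.get ⟨i, h⟩ ≤ numAscents (w.take i) + 1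

/-- A word `π` contains the pattern `τ` if it has a subsequence order-isomorphic to `τ`. -/
def Contains (π τ : List ℕ) : Prop :=
  ∃ f : Fin τ.length → Fin π.length, StrictMono f ∧
    ∀ i j, (π.get (f i) < π.get (f j) ↔ τ.get i < τ.get j) ∧
      (π.get (f i) > π.get (f j) ↔ τ.get i > τ.get j)

/-- A word avoids a pattern if it does not contain it. -/
def Avoids (π τ : List ℕ) : Prop := ¬ Contains π τ

/-- The number of ascent sequences of length `n` avoiding every pattern in `T`. -/
noncomputable def avoiderCount (n : ℕ) (T : List (List ℕ)) : ℕ :=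
  {w : List ℕ | w.length = n ∧ IsAscentSeq w ∧ ∀ τ ∈ T, Avoids w τ}.ncard

namespace AvoidCatalan

/-- The Catalan generating function over the integers. -/
noncomputable def catSeries : PowerSeries ℤ :=
  PowerSeries.catalanSeries.map (Nat.castRingHom ℤ)

theorem catSeries_eq : catSeries = 1 + PowerSeries.X * catSeries ^ 2 := by
  have h := congrArg (PowerSeries.map (Nat.castRingHom ℤ))
    PowerSeries.catalanSeries_sq_mul_X_add_one
  simp only [map_add, map_mul, map_pow, PowerSeries.map_X, map_one] at h
  rw [catSeries]
  linear_combination -h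

theorem coeff_catSeries_sq (k : ℕ) :
    PowerSeries.coeff k (catSeries ^ 2) = (catalan (k + 1) : ℤ) := by
  have h := congrArg (PowerSeries.coeff (k + 1)) catSeries_eq
  rw [map_add, PowerSeries.coeff_succ_X_mul] at h
  simpa [catSeries, PowerSeries.coeff_one] using h.symm

/-- The generating function of the ways to continue an ascent sequence with weakly increasing
nonzero letters that ends in zero, where the next letter may exceed the maximum by at most `d`. -/
noncomputable def zeroSeries (d : ℕ) : PowerSeries ℤ :=
  catSeries ^ (2 * d + 2) * (1 - PowerSeries.X) ^ d

/-- The generating function of the ways to continue an ascent sequence with weakly increasing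
nonzero letters that ends in its maximum, where the next letter may exceed the maximum by at
most `d + 1`. -/
noncomputable def maxSeries (d : ℕ) : PowerSeries ℤ :=
  catSeries ^ (2 * d + 3) * (1 - PowerSeries.X) ^ d

theorem zeroSeries_eq (d : ℕ) :
    zeroSeries d = 1 + PowerSeries.X *
      (zeroSeries d + ∑ j ∈ Finset.range (d + 1), maxSeries j) := by
  have hC := catSeries_eq
  induction d with
  | zero =>
    simp only [zeroSeries, maxSeries, zero_add, Finset.sum_range_one, mul_zero]
    linear_combination (catSeries + 1) * hC
  | succ d ih =>
    rw [Finset.sum_range_succ]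
    simp only [zeroSeries, maxSeries] at ih ⊢
    linear_combination ih +
      (1 - PowerSeries.X) ^ (d + 1) * catSeries ^ (2 * d + 2) * (catSeries + 1) * hC

theorem maxSeries_eq (d : ℕ) :
    maxSeries d = 1 + PowerSeries.X *
      (zeroSeries (d + 1) + maxSeries d + ∑ j ∈ Finset.range (d + 1), maxSeries j) := by
  have h := zeroSeries_eq (d + 1)
  rw [Finset.sum_range_succ] at h
  have hC := catSeries_eq
  have key : zeroSeries (d + 1) - maxSeries d =
      PowerSeries.X * (maxSeries (d + 1) - maxSeries d) := by
    simp only [zeroSeries, maxSeries]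
    linear_combination
      (1 - PowerSeries.X) ^ (d + 1) * catSeries ^ (2 * d + 3) * hC
  linear_combination h - key

/-- The words of length `k` that continue an ascent sequence with maximum `m`, `a` ascents and last
letter `l`, keeping the nonzero letters weakly increasing. -/
def extensions : ℕ → ℕ → ℕ → ℕ → Finset (List ℕ)
  | 0, _, _, _ => {[]}
  | k + 1, m, a, l =>
    (insert 0 (Finset.Icc (max m 1) (a + 1))).biUnion fun z =>
      (extensions k (max m z) (a + if l < z then 1 else 0) z).image (List.cons z)

theorem card_extensions_succ (k m a l : ℕ) :
    (extensions (k + 1) m a l).card = (extensions k m a 0).card +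
      ∑ z ∈ Finset.Icc (max m 1) (a + 1),
        (extensions k (max m z) (a + if l < z then 1 else 0) z).card := by
  rw [extensions, Finset.card_biUnion, Finset.sum_insert (by simp)]
  · simp [Finset.card_image_of_injective _ (List.cons_injective)]
  · intro x _ y _ hxy
    rw [Function.onFun, Finset.disjoint_left]
    simp only [Finset.mem_image]
    rintro _ ⟨s, _, rfl⟩ ⟨t, _, h⟩
    exact hxy (List.cons.inj h).1.symm

theorem sum_Icc_eq_sum_range {M : Type*} [AddCommMonoid M] (f : ℕ → M) (m d : ℕ) :
    ∑ z ∈ Finset.Icc m (m + d), f z = ∑ i ∈ Finset.range (d + 1), f (m + i) := by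
  rw [← Finset.Ico_add_one_right_eq_Icc, Finset.sum_Ico_eq_sum_range]
  congr 2
  omega

theorem card_extensions (k : ℕ) :
    (∀ m d, ((extensions k (m + 1) (m + d) 0).card : ℤ) =
      PowerSeries.coeff k (zeroSeries d)) ∧
    ∀ m d, ((extensions k (m + 1) (m + d + 1) (m + 1)).card : ℤ) =
      PowerSeries.coeff k (maxSeries d) := by
  induction k with
  | zero =>
    constructor <;> intro m d
    · rw [zeroSeries_eq]; simp [extensions]
    · rw [maxSeries_eq]; simp [extensions]
  | succ k ih =>
    obtain ⟨hZ, hN⟩ := ih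
    constructor <;> intro m d
    · rw [zeroSeries_eq, card_extensions_succ, map_add, PowerSeries.coeff_succ_X_mul]
      rw [max_eq_left (by omega), show m + d + 1 = m + 1 + d by omega, sum_Icc_eq_sum_range]
      push_cast
      rw [hZ, ← Finset.sum_range_reflect]
      simp only [map_add, map_sum, PowerSeries.coeff_one]
      rw [if_neg (Nat.succ_ne_zero k), zero_add]
      congr 1
      refine Finset.sum_congr rfl fun i hi => ?_
      rw [Finset.mem_range] at hi
      rw [← hN (m + (d - i)) i, if_pos (by omega), max_eq_right (by omega)]
      congr 3 <;> omega
    · rw [maxSeries_eq, card_extensions_succ, map_add, PowerSeries.coeff_succ_X_mul]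
      rw [max_eq_left (by omega), show m + d + 1 + 1 = m + 1 + (d + 1) by omega,
        sum_Icc_eq_sum_range, Finset.sum_range_succ']
      push_cast
      rw [add_assoc m d 1, hZ, ← Finset.sum_range_reflect]
      simp only [map_add, map_sum, PowerSeries.coeff_one]
      rw [if_neg (Nat.succ_ne_zero k), zero_add,
        add_right_comm _ (PowerSeries.coeff k (maxSeries d)),
        add_assoc (PowerSeries.coeff k (zeroSeries (d + 1)))]
      congr 2
      · refine Finset.sum_congr rfl fun i hi => ?_
        rw [Finset.mem_range] at hi
        rw [← hN (m + (d - i) + 1) i, if_pos (by omega), max_eq_right (by omega)]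
        congr 3 <;> omega
      · rw [← hN m d]
        simp [add_assoc]

theorem card_extensions_start (k : ℕ) : (extensions k 0 0 0).card = catalan (k + 1) := by
  have h : ((extensions k 0 0 0).card : ℤ) = PowerSeries.coeff k (zeroSeries 0) := by
    induction k with
    | zero => rw [zeroSeries_eq]; simp [extensions]
    | succ k ih =>
      rw [zeroSeries_eq, card_extensions_succ, map_add, PowerSeries.coeff_succ_X_mul]
      have := (card_extensions k).2 0 0
      simp only [zero_add] at this
      simp [ih, this, PowerSeries.coeff_one]
  rw [zeroSeries, pow_zero, mul_one, coeff_catSeries_sq] at h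
  exact_mod_cast h

theorem numAscents_cons_cons (a b : ℕ) (l : List ℕ) :
    numAscents (a :: b :: l) = numAscents (b :: l) + if a < b then 1 else 0 := by
  simp [numAscents, List.countP_cons]

theorem numAscents_concat (a : ℕ) (l : List ℕ) (z : ℕ) :
    numAscents (a :: l ++ [z]) =
      numAscents (a :: l) + if (a :: l).getLastD 0 < z then 1 else 0 := by
  induction l generalizing a with
  | nil => simp [numAscents]
  | cons b l ih =>
    have := ih b
    simp only [List.cons_append] at this ⊢
    rw [numAscents_cons_cons, this, numAscents_cons_cons]
    simp only [List.getLastD_cons]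
    omega

theorem numAscents_eq_zero {w : List ℕ} (h : ∀ x ∈ w, x = 0) : numAscents w = 0 := by
  rw [numAscents, List.countP_eq_zero]
  rintro ⟨a, b⟩ hab
  have := h b (List.mem_of_mem_tail (List.of_mem_zip hab).2)
  simp [this]

theorem isAscentSeq_concat {w : List ℕ} (hw : w ≠ []) (z : ℕ) :
    IsAscentSeq (w ++ [z]) ↔ IsAscentSeq w ∧ z ≤ numAscents w + 1 := by
  have hpos := List.length_pos_of_ne_nil hw
  simp only [IsAscentSeq, List.get_eq_getElem, List.head?_append_of_ne_nil _ hw, and_assoc]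
  refine and_congr_right fun _ => ⟨fun h => ⟨fun i hi h1 => ?_, ?_⟩, fun ⟨h, hz⟩ i hi h1 => ?_⟩
  · have := h i (by simp; omega) h1
    rwa [List.getElem_append_left hi, List.take_append_of_le_length hi.le] at this
  · simpa using h w.length (by simp) hpos
  · rcases Nat.lt_or_ge i w.length with hlt | hge
    · rw [List.getElem_append_left hlt, List.take_append_of_le_length hlt.le]
      exact h i hlt h1
    · obtain rfl : i = w.length := by simp at hi; omega
      simpa using hz

/-- The ascent sequences whose nonzero letters are weakly increasing. -/
def IsMonotoneAscentSeq (w : List ℕ) : Prop :=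
  IsAscentSeq w ∧ w.Pairwise fun a b => b = 0 ∨ a ≤ b

theorem foldl_max_le_iff (w : List ℕ) (m z : ℕ) :
    w.foldl max m ≤ z ↔ m ≤ z ∧ ∀ x ∈ w, x ≤ z := by
  induction w generalizing m with
  | nil => simp
  | cons a l ih => simp [ih, and_assoc]

theorem isMonotoneAscentSeq_concat {w : List ℕ} (hw : w ≠ []) (z : ℕ) :
    IsMonotoneAscentSeq (w ++ [z]) ↔ IsMonotoneAscentSeq w ∧
      z ∈ insert 0 (Finset.Icc (max (w.foldl max 0) 1) (numAscents w + 1)) := by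
  simp only [IsMonotoneAscentSeq, isAscentSeq_concat hw, List.pairwise_append, Finset.mem_insert,
    Finset.mem_Icc, max_le_iff, foldl_max_le_iff, List.mem_singleton, forall_eq,
    List.pairwise_singleton, true_and, zero_le]
  rcases Nat.eq_zero_or_pos z with rfl | hz
  · simp
  · simp only [hz.ne', false_or, Nat.succ_le_of_lt hz]
    tauto

theorem IsMonotoneAscentSeq.of_append {w t : List ℕ} (hw : w ≠ [])
    (h : IsMonotoneAscentSeq (w ++ t)) : IsMonotoneAscentSeq w := by
  induction t using List.reverseRecOn with
  | nil => simpa using h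
  | append_singleton t z ih =>
    rw [← List.append_assoc, isMonotoneAscentSeq_concat (by simp [hw])] at h
    exact ih h.1

theorem mem_extensions {w : List ℕ} (hw : w ≠ []) (hg : IsMonotoneAscentSeq w) (k : ℕ)
    (t : List ℕ) :
    t ∈ extensions k (w.foldl max 0) (numAscents w) (w.getLastD 0) ↔
      t.length = k ∧ IsMonotoneAscentSeq (w ++ t) := by
  induction k generalizing w t with
  | zero =>
    simp only [extensions, Finset.mem_singleton, List.length_eq_zero_iff]
    exact ⟨by rintro rfl; simpa using hg, fun h => h.1⟩
  | succ k ih =>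
    have step (z : ℕ) (hz : IsMonotoneAscentSeq (w ++ [z])) (s : List ℕ) :
        s ∈ extensions k (max (w.foldl max 0) z)
          (numAscents w + if w.getLastD 0 < z then 1 else 0) z ↔
        s.length = k ∧ IsMonotoneAscentSeq (w ++ z :: s) := by
      have := ih (w := w ++ [z]) (by simp) hz s
      obtain ⟨a, l, rfl⟩ := List.exists_cons_of_ne_nil hw
      rw [numAscents_concat, List.getLastD_concat] at this
      simpa using this
    simp only [extensions, Finset.mem_biUnion, Finset.mem_image]
    constructor
    · rintro ⟨z, hz, s, hs, rfl⟩
      have := (step z ((isMonotoneAscentSeq_concat hw z).2 ⟨hg, hz⟩) s).1 hs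
      exact ⟨by simp [this.1], this.2⟩
    · rintro ⟨hl, ht⟩
      obtain ⟨z, s, rfl⟩ := List.exists_cons_of_length_eq_add_one hl
      have hz : IsMonotoneAscentSeq (w ++ [z]) :=
        IsMonotoneAscentSeq.of_append (t := s) (by simp) (by simpa using ht)
      exact ⟨z, ((isMonotoneAscentSeq_concat hw z).1 hz).2, s,
        (step z hz s).2 ⟨by simpa using hl, ht⟩, rfl⟩

theorem exists_eq_one_of_ne_zero {w : List ℕ} (hw : IsAscentSeq w) {i : ℕ} (hi : i < w.length)
    (h : w[i] ≠ 0) : ∃ p, ∃ hp : p < w.length, 1 ≤ p ∧ p ≤ i ∧ w[p] = 1 := by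
  classical
  have hex : ∃ p, ∃ hp : p < w.length, w[p] ≠ 0 := ⟨i, hi, h⟩
  obtain ⟨hp, hne⟩ := Nat.find_spec hex
  have hmin : ∀ q (hq : q < w.length), q < Nat.find hex → w[q] = 0 := fun q hq hlt => by
    simpa [hq] using Nat.find_min hex hlt
  have h0 : 1 ≤ Nat.find hex := by
    rw [Nat.one_le_iff_ne_zero]
    intro h0
    apply hne
    have := hw.1
    rw [List.head?_eq_getElem?, List.getElem?_eq_some_iff] at this
    simpa [h0] using this.2
  refine ⟨Nat.find hex, hp, h0, Nat.find_min' hex ⟨hi, h⟩, ?_⟩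
  have hle : w[Nat.find hex] ≤ _ := hw.2 _ hp h0
  rw [numAscents_eq_zero] at hle
  · omega
  · intro x hx
    obtain ⟨q, hq, rfl⟩ := List.mem_take_iff_getElem.1 hx
    exact hmin q (by omega) (by omega)

theorem avoids_iff_pairwise {w : List ℕ} (hw : IsAscentSeq w) :
    (∀ τ ∈ [[0, 1, 2, 1], [0, 1, 3, 2]], Avoids w τ) ↔
      w.Pairwise fun a b => b = 0 ∨ a ≤ b := by
  simp only [List.mem_cons, List.not_mem_nil, or_false, forall_eq_or_imp, forall_eq]
  constructor
  · rintro ⟨h1, h2⟩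
    rw [List.pairwise_iff_getElem]
    intro i j hi hj hij
    by_contra! hcon
    obtain ⟨hj0, hlt⟩ := hcon
    obtain ⟨p, hp, hp1, hpi, hwp⟩ := exists_eq_one_of_ne_zero hw hi (by omega)
    have hpi' : p < i := lt_of_le_of_ne hpi (by rintro rfl; omega)
    have h00 : w[0] = 0 := by
      have := hw.1
      rw [List.head?_eq_getElem?, List.getElem?_eq_some_iff] at this
      exact this.2
    have hmono : StrictMono (![⟨0, by omega⟩, ⟨p, hp⟩, ⟨i, hi⟩, ⟨j, hj⟩] : Fin 4 → Fin w.length) := by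
      rw [Fin.strictMono_iff_lt_succ]
      intro x
      fin_cases x <;> simp [Fin.lt_def] <;> omega
    rcases Nat.lt_or_ge 1 w[j] with hj1 | hj1
    · refine h2 ⟨_, hmono, ?_⟩
      intro x y
      fin_cases x <;> fin_cases y <;> simp [h00, hwp] <;> omega
    · refine h1 ⟨_, hmono, ?_⟩
      intro x y
      fin_cases x <;> fin_cases y <;> simp [h00, hwp] <;> omega
  · intro h
    rw [List.pairwise_iff_get] at h
    constructor
    · rintro ⟨f, hf, hτ⟩
      have h23 := h (f 2) (f 3) (hf (by decide))
      have h1 := (hτ 2 3).2.2 (by decide)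
      have h2 := (hτ 0 3).1.2 (by decide)
      omega
    · rintro ⟨f, hf, hτ⟩
      have h23 := h (f 2) (f 3) (hf (by decide))
      have h1 := (hτ 2 3).2.2 (by decide)
      have h2 := (hτ 0 3).1.2 (by decide)
      omega

end AvoidCatalan

open AvoidCatalan in
/-- The number of ascent sequences of length `n` avoiding both patterns equals
the Catalan number $C_n$. -/
theorem catalan_count_avoid_0121_0132 (n : ℕ) (hn : 1 ≤ n) :
    avoiderCount n [[0,1,2,1], [0,1,3,2]] = catalan n := by
  obtain ⟨k, rfl⟩ := Nat.exists_eq_add_of_le' hn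
  have h0 : IsMonotoneAscentSeq [0] := by
    refine ⟨⟨rfl, fun i hi h1 => ?_⟩, by simp⟩
    simp at hi
    omega
  have hset : {w : List ℕ | w.length = k + 1 ∧ IsAscentSeq w ∧
      ∀ τ ∈ [[0,1,2,1], [0,1,3,2]], Avoids w τ} =
      ((extensions k 0 0 0).image (List.cons 0) : Finset (List ℕ)) := by
    ext w
    have hmem := mem_extensions (w := [0]) (by simp) h0 k
    simp only [Set.mem_ofPred_eq, Finset.coe_image, Set.mem_image, Finset.mem_coe]
    constructor
    · rintro ⟨hl, hw, hav⟩
      obtain ⟨z, s, rfl⟩ := List.exists_cons_of_length_eq_add_one hl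
      obtain rfl : z = 0 := by simpa using hw.1
      exact ⟨s, (hmem s).2 ⟨by simpa using hl, hw, (avoids_iff_pairwise hw).1 hav⟩, rfl⟩
    · rintro ⟨s, hs, rfl⟩
      obtain ⟨hl, hw, hp⟩ := (hmem s).1 hs
      exact ⟨by simp [hl], hw, (avoids_iff_pairwise hw).2 hp⟩
  rw [avoiderCount, hset, Set.ncard_coe_finset,
    Finset.card_image_of_injective _ List.cons_injective, card_extensions_start]
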